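/- Let (𝔻ⁿ,σ) be the flat disk and α ∈ (0,1). Define f_j radially on [0,1] × 𝔻ⁿ by f_j(r) = j^α for r ∈ [0, 1/(2j)], f_j(r) = h_j(r) for r ∈ [1/(2j), 1/j] where h_j is any decreasing continuous function with h_j(1/(2j)) = j^α and h_j(1/j) = 1, and f_j(r) = 1 otherwise; set g_j = −dt² + f_j²σ and g₀ = −dt² + σ on M = [0,1] × 𝔻ⁿ. Then d̂_{t,g₀}(p,q) ≤ d̂_{t,g_j}(p,q) ≤ d̂_{t,g₀}(p,q) + 2/j + 2 j^{α−1} for all p, q ∈ M; in particular d̂_{t,g_j} → d̂_{t,g₀} uniformly. -/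

import Mathlib

open Set MeasureTheory Filter Topology

namespace NullDistPaper

variable {S : Type*} [PseudoMetricSpace S]

/-- A future-directed causal piece of a curve in the warped product spacetime
`([t₀,t₁] × S, -dt² + f(t,x)² σ)`, parametrized by the time coordinate on `[a,b]`:
the spatial part `x` is continuous, and its σ-length (total variation) over any
subinterval is at most the corresponding integral of `1/f` along the curve. -/
def FutureCausalPiece (f : ℝ → S → ℝ) (x : ℝ → S) (a b : ℝ) : Prop :=
  a ≤ b ∧ ContinuousOn x (Set.Icc a b) ∧
    ∀ c ∈ Set.Icc a b, ∀ d ∈ Set.Icc a b, c ≤ d →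
      eVariationOn x (Set.Icc c d) ≤ ENNReal.ofReal (∫ t in c..d, 1 / f t (x t))

/-- `q` lies in the causal future of `p`, i.e. there is a future-directed causal
curve from `p` to `q`. -/
def FutureRelated (f : ℝ → S → ℝ) (p q : ℝ × S) : Prop :=
  p.1 ≤ q.1 ∧ ∃ x : ℝ → S, x p.1 = p.2 ∧ x q.1 = q.2 ∧ FutureCausalPiece f x p.1 q.1

/-- `q ∈ J^±(p)` : `q` is causally related to `p`. -/
def CausallyRelated (f : ℝ → S → ℝ) (p q : ℝ × S) : Prop :=
  FutureRelated f p q ∨ FutureRelated f q p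

/-- A piecewise causal curve in `[t₀,t₁] × S` from `p` to `q`, recorded by its
breakpoints; consecutive breakpoints are joined by a future- or past-directed
causal piece. -/
structure PiecewiseCausal (f : ℝ → S → ℝ) (t₀ t₁ : ℝ) (p q : ℝ × S) where
  k : ℕ
  hk : 0 < k
  pt : ℕ → ℝ × S
  h0 : pt 0 = p
  hlast : pt k = q
  hstrip : ∀ i ≤ k, (pt i).1 ∈ Set.Icc t₀ t₁
  piece : ∀ i < k, CausallyRelated f (pt i) (pt (i + 1))

/-- The null length of a piecewise causal curve with respect to the
time function `τ`. -/
noncomputable def nullLength (τ : ℝ × S → ℝ) {f : ℝ → S → ℝ} {t₀ t₁ : ℝ} {p q : ℝ × S}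
    (γ : PiecewiseCausal f t₀ t₁ p q) : ℝ :=
  ∑ i ∈ Finset.range γ.k, |τ (γ.pt (i + 1)) - τ (γ.pt i)|

/-- The null distance on `[t₀,t₁] × S` for the warped product `-dt² + f(t,x)²σ`
and the time function `τ`. -/
noncomputable def nullDist (f : ℝ → S → ℝ) (τ : ℝ × S → ℝ) (t₀ t₁ : ℝ) (p q : ℝ × S) : ℝ :=
  sInf {L : ℝ | ∃ γ : PiecewiseCausal f t₀ t₁ p q, L = nullLength τ γ}

/-- Warping function depending only on the time coordinate. -/
def tWarp (f : ℝ → ℝ) : ℝ → S → ℝ := fun t _ => f t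

/-- The metric of `S` is intrinsic (a length metric): any two points can be
joined by continuous curves of length arbitrarily close to their distance.
This encodes that `(S, d)` comes from a (continuous) Riemannian metric. -/
def IsLengthSpace (S : Type*) [PseudoMetricSpace S] : Prop :=
  ∀ x y : S, ∀ ε > 0, ∃ γ : ℝ → S, γ 0 = x ∧ γ 1 = y ∧ ContinuousOn γ (Set.Icc 0 1) ∧
    eVariationOn γ (Set.Icc 0 1) ≤ ENNReal.ofReal (dist x y + ε)

end NullDistPaper

open NullDistPaper Set Filter

namespace NullDistPaper

/-- The flat unit disk `𝔻ⁿ ⊆ ℝⁿ` (with its flat, i.e. Euclidean, metric). -/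
abbrev Disk (n : ℕ) : Type := (Metric.closedBall (0 : EuclideanSpace ℝ (Fin n)) 1 : Set _)

end NullDistPaper


namespace NullDistPaper

section Helpers

variable {X : Type*} [MetricSpace X]

def Reach (f : ℝ → X → ℝ) (p q : ℝ × X) (L : ℝ) : Prop :=
  ∃ γ : PiecewiseCausal f 0 1 p q, nullLength (fun p => p.1) γ ≤ L

theorem Reach.mono {f : ℝ → X → ℝ} {p q : ℝ × X} {L L' : ℝ} (h : Reach f p q L) (hl : L ≤ L') :
    Reach f p q L' := by
  obtain ⟨γ, hγ⟩ := h
  exact ⟨γ, hγ.trans hl⟩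

theorem Reach.single {f : ℝ → X → ℝ} {p q : ℝ × X} (hp : p.1 ∈ Icc (0:ℝ) 1)
    (hq : q.1 ∈ Icc (0:ℝ) 1) (h : CausallyRelated f p q) : Reach f p q |q.1 - p.1| := by
  refine ⟨⟨1, one_pos, fun i => if i = 0 then p else q, by simp, by simp, ?_, ?_⟩, ?_⟩
  · intro i _
    split_ifs <;> assumption
  · intro i hi
    obtain rfl : i = 0 := by omega
    simpa using h
  · simp [nullLength]

theorem Reach.trans {f : ℝ → X → ℝ} {p q r : ℝ × X} {L L' : ℝ} (h : Reach f p q L)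
    (h' : Reach f q r L') : Reach f p r (L + L') := by
  obtain ⟨γ, hγ⟩ := h
  obtain ⟨δ, hδ⟩ := h'
  refine ⟨⟨γ.k + δ.k, by have := γ.hk; omega,
    fun i => if i ≤ γ.k then γ.pt i else δ.pt (i - γ.k), ?_, ?_, ?_, ?_⟩, ?_⟩
  · simp [γ.h0]
  · have := δ.hk
    simp [this.ne', δ.hlast]
  · intro i hi
    split_ifs with h
    · exact γ.hstrip i h
    · exact δ.hstrip _ (by omega)
  · intro i hi
    rcases lt_trichotomy i γ.k with h | h | h
    · rw [if_pos h.le, if_pos (by omega)]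
      exact γ.piece i h
    · subst h
      rw [if_pos le_rfl, if_neg (by omega), γ.hlast, Nat.add_sub_cancel_left]
      have h := δ.piece 0 δ.hk
      rwa [δ.h0] at h
    · rw [if_neg (by omega), if_neg (by omega), show i + 1 - γ.k = (i - γ.k) + 1 by omega]
      exact δ.piece _ (by omega)
  · refine le_trans (le_of_eq ?_) (add_le_add hγ hδ)
    unfold nullLength
    dsimp only
    rw [Finset.sum_range_add]
    congr 1
    · refine Finset.sum_congr rfl fun i hi => ?_
      have := Finset.mem_range.1 hi
      rw [if_pos (by omega), if_pos (by omega)]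
    · refine Finset.sum_congr rfl fun i hi => ?_
      rw [if_neg (by omega), show γ.k + i + 1 - γ.k = i + 1 by omega]
      by_cases h0 : i = 0
      · subst h0
        rw [if_pos (by omega), δ.h0, add_zero, γ.hlast]
      · rw [if_neg (by omega), Nat.add_sub_cancel_left]

theorem bddBelow_null (f : ℝ → X → ℝ) (p q : ℝ × X) :
    BddBelow {L : ℝ | ∃ γ : PiecewiseCausal f 0 1 p q, L = nullLength (fun p => p.1) γ} := by
  refine ⟨0, ?_⟩
  rintro _ ⟨γ, rfl⟩
  exact Finset.sum_nonneg fun _ _ => abs_nonneg _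

theorem Reach.nullDist_le {f : ℝ → X → ℝ} {p q : ℝ × X} {L : ℝ} (h : Reach f p q L) :
    nullDist f (fun p => p.1) 0 1 p q ≤ L := by
  obtain ⟨γ, hγ⟩ := h
  exact (csInf_le (bddBelow_null f p q) ⟨γ, rfl⟩).trans hγ

theorem eVar_le {x : ℝ → X} {K c d : ℝ} (hK : 0 ≤ K)
    (hx : ∀ u v, dist (x u) (x v) ≤ K * |u - v|) (hcd : c ≤ d) :
    eVariationOn x (Icc c d) ≤ ENNReal.ofReal (K * (d - c)) := by
  have hL : LipschitzWith K.toNNReal x := LipschitzWith.of_dist_le_mul fun u v => by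
    rw [Real.coe_toNNReal K hK, Real.dist_eq]; exact hx u v
  have h1 := (hL.lipschitzOnWith (s := univ)).comp_eVariationOn_le (g := id)
    (s := Icc c d) (mapsTo_univ _ _)
  have h2 := (monotoneOn_id (s := Icc c d)).eVariationOn_le (left_mem_Icc.2 hcd)
    (right_mem_Icc.2 hcd)
  rw [inter_self] at h2
  refine h1.trans ?_
  rw [ENNReal.ofReal_mul hK]
  exact mul_le_mul' le_rfl h2

theorem future_line {f : X → ℝ} (hf : Continuous f) (hf1 : ∀ x, 1 ≤ f x) {ℓ : ℝ → X} {D : ℝ}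
    (hD : 0 ≤ D) (hl : ∀ u v, dist (ℓ u) (ℓ v) ≤ D * |u - v|) {C : ℝ} (hC : 1 ≤ C)
    {s t l m : ℝ} (hst : s ≤ t)
    (hfC : ∀ θ ∈ Ioo (min l m) (max l m), f (ℓ θ) ≤ C)
    (hL : C * (D * |m - l|) ≤ t - s) :
    FutureRelated (fun _ x => f x) (s, ℓ l) (t, ℓ m) := by
  refine ⟨hst, ?_⟩
  have hnn : 0 ≤ D * |m - l| := by positivity
  have hlc : Continuous ℓ := (LipschitzWith.of_dist_le_mul (K := D.toNNReal) fun u v => by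
    rw [Real.coe_toNNReal D hD, Real.dist_eq]; exact hl u v).continuous
  rcases hnn.eq_or_lt with h0 | hpos
  · have he : ℓ l = ℓ m := by
      apply dist_le_zero.1
      rw [dist_comm]
      exact (hl m l).trans h0.symm.le
    refine ⟨fun _ => ℓ l, rfl, he, hst, continuousOn_const, ?_⟩
    intro c _ d _ _
    rw [eVariationOn.constant_on (by
      rintro _ ⟨_, _, rfl⟩ _ ⟨_, _, rfl⟩
      rfl)]
    exact zero_le
  · have hst' : s < t := by nlinarith
    have hts : 0 < t - s := by linarith
    have hlm : l ≠ m := by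
      rintro rfl
      simp at hpos
    set y : ℝ → ℝ := fun τ => l + (τ - s) / (t - s) * (m - l) with hy
    have hyc : Continuous y := by fun_prop
    refine ⟨fun τ => ℓ (y τ), by simp [hy], by simp [hy, hts.ne'], hst,
      (hlc.comp hyc).continuousOn, ?_⟩
    intro c hc d hd hcd
    have hxl : ∀ u v, dist (ℓ (y u)) (ℓ (y v)) ≤ (D * |m - l| / (t - s)) * |u - v| := by
      intro u v
      refine (hl _ _).trans (le_of_eq ?_)
      have : y u - y v = (u - v) / (t - s) * (m - l) := by simp only [hy]; ring
      rw [this, abs_mul, abs_div, abs_of_pos hts]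
      ring
    refine (eVar_le (by positivity) hxl hcd).trans (ENNReal.ofReal_le_ofReal ?_)
    have hC0 : 0 < C := by linarith
    have h1 : D * |m - l| / (t - s) ≤ 1 / C := by
      rw [div_le_div_iff₀ hts hC0]; linarith
    have h2 : ∫ τ in c..d, (1 / C : ℝ) = (d - c) * (1 / C) := by simp
    calc D * |m - l| / (t - s) * (d - c) ≤ 1 / C * (d - c) := by
          apply mul_le_mul_of_nonneg_right h1; linarith
      _ = ∫ τ in c..d, (1 / C : ℝ) := by rw [h2]; ring
      _ ≤ _ := by
        apply intervalIntegral.integral_mono_on_of_le_Ioo hcd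
        · exact intervalIntegrable_const
        · apply Continuous.intervalIntegrable
          have : Continuous fun τ => f (ℓ (y τ)) := hf.comp (hlc.comp hyc)
          exact continuous_const.div this fun τ => by have := hf1 (ℓ (y τ)); positivity
        · intro τ hτ
          have hfp : 0 < f (ℓ (y τ)) := by have := hf1 (ℓ (y τ)); linarith
          apply one_div_le_one_div_of_le hfp
          apply hfC
          have ha : 0 < (τ - s) / (t - s) := by
            apply div_pos _ hts; linarith [hc.1, hτ.1]
          have hb : (τ - s) / (t - s) < 1 := by
            rw [div_lt_one hts]; linarith [hd.2, hτ.2]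
          simp only [hy]
          rcases lt_or_gt_of_ne hlm with h | h
          · rw [min_eq_left h.le, max_eq_right h.le]
            constructor <;> nlinarith
          · rw [min_eq_right h.le, max_eq_left h.le]
            constructor <;> nlinarith

theorem reach_base {f : X → ℝ} (hf : Continuous f) (hf1 : ∀ x, 1 ≤ f x) {ℓ : ℝ → X} {D : ℝ}
    (hD : 0 ≤ D) (hl : ∀ u v, dist (ℓ u) (ℓ v) ≤ D * |u - v|) {C : ℝ} (hC : 1 ≤ C)
    {s t l m : ℝ} (hs : s ∈ Icc (0:ℝ) 1) (ht : t ∈ Icc (0:ℝ) 1) (hlm : l ≤ m)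
    (hfC : ∀ θ ∈ Ioo l m, f (ℓ θ) ≤ C)
    (hL : C * (D * (m - l)) ≤ 1 / 2) :
    Reach (fun _ x => f x) (s, ℓ l) (t, ℓ m) (max |t - s| (C * (D * (m - l)))) := by
  set L := C * (D * (m - l)) with hLd
  rcases le_or_gt L |t - s| with h | h
  · rw [max_eq_left h]
    refine Reach.single (p := (s, ℓ l)) (q := (t, ℓ m)) hs ht ?_
    rcases le_total s t with hst | hst
    · left
      apply future_line hf hf1 hD hl hC hst
      · rwa [min_eq_left hlm, max_eq_right hlm]
      · rw [abs_of_nonneg (sub_nonneg.2 hlm)]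
        rwa [abs_of_nonneg (sub_nonneg.2 hst)] at h
    · right
      apply future_line hf hf1 hD hl hC hst
      · rwa [min_eq_right hlm, max_eq_left hlm]
      · rw [abs_sub_comm, abs_of_nonneg (sub_nonneg.2 hlm)]
        rwa [abs_sub_comm, abs_of_nonneg (sub_nonneg.2 hst)] at h
  · rw [max_eq_right h.le]
    have hLp : 0 < L := (abs_nonneg _).trans_lt h
    obtain ⟨h1, h2⟩ := abs_lt.1 h
    obtain ⟨hs0, hs1⟩ := hs
    obtain ⟨ht0, ht1⟩ := ht
    -- general mid point
    have key : ∀ e : ℝ, 0 ≤ e → e ≤ 1 → ∃ w, l ≤ w ∧ w ≤ m ∧ C * (D * |w - l|) = e * L ∧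
        C * (D * |w - m|) = (1 - e) * L := by
      intro e he0 he1
      refine ⟨l + e * (m - l), by nlinarith, by nlinarith, ?_, ?_⟩
      · rw [add_sub_cancel_left, abs_of_nonneg (mul_nonneg he0 (sub_nonneg.2 hlm)), hLd]; ring
      · rw [show l + e * (m - l) - m = -((1 - e) * (m - l)) by ring, abs_neg,
          abs_of_nonneg (mul_nonneg (sub_nonneg.2 he1) (sub_nonneg.2 hlm)), hLd]; ring
    rcases le_or_gt s (1/2) with hsm | hsm
    · obtain ⟨w, hw1, hw2, hw3, hw4⟩ := key ((L + (t - s)) / (2 * L))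
        (div_nonneg (by linarith) (by linarith)) ((div_le_one (by linarith)).2 (by linarith))
      have e1 : (L + (t - s)) / (2 * L) * L = (L + (t - s)) / 2 := by field_simp
      have e2 : (1 - (L + (t - s)) / (2 * L)) * L = (L - (t - s)) / 2 := by rw [sub_mul, e1]; ring
      rw [e1] at hw3
      rw [e2] at hw4
      have hu : s + (L + (t - s)) / 2 ∈ Icc (0:ℝ) 1 := by constructor <;> linarith
      have r1 := Reach.single (f := fun _ x => f x) (p := (s, ℓ l)) (q := (s + (L + (t - s)) / 2, ℓ w))
        ⟨hs0, hs1⟩ hu (Or.inl (future_line hf hf1 hD hl hC (by linarith) (fun θ hθ => by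
          rw [min_eq_left hw1, max_eq_right hw1] at hθ
          exact hfC θ ⟨hθ.1, hθ.2.trans_le hw2⟩) (by rw [hw3]; linarith)))
      have r2 := Reach.single (f := fun _ x => f x) (p := (s + (L + (t - s)) / 2, ℓ w)) (q := (t, ℓ m))
        hu ⟨ht0, ht1⟩ (Or.inr (future_line hf hf1 hD hl hC (by linarith) (fun θ hθ => by
          rw [min_eq_right hw2, max_eq_left hw2] at hθ
          exact hfC θ ⟨hw1.trans_lt hθ.1, hθ.2⟩) (by rw [hw4]; linarith)))
      refine (r1.trans r2).mono ?_
      dsimp only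
      rw [abs_of_nonneg (by linarith), abs_of_nonpos (by linarith)]
      linarith
    · obtain ⟨w, hw1, hw2, hw3, hw4⟩ := key ((L - (t - s)) / (2 * L))
        (div_nonneg (by linarith) (by linarith)) ((div_le_one (by linarith)).2 (by linarith))
      have e1 : (L - (t - s)) / (2 * L) * L = (L - (t - s)) / 2 := by field_simp
      have e2 : (1 - (L - (t - s)) / (2 * L)) * L = (L + (t - s)) / 2 := by rw [sub_mul, e1]; ring
      rw [e1, abs_sub_comm] at hw3
      rw [e2, abs_sub_comm] at hw4
      have hu : s - (L - (t - s)) / 2 ∈ Icc (0:ℝ) 1 := by constructor <;> linarith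
      have r1 := Reach.single (f := fun _ x => f x) (p := (s, ℓ l)) (q := (s - (L - (t - s)) / 2, ℓ w))
        ⟨hs0, hs1⟩ hu (Or.inr (future_line hf hf1 hD hl hC (by linarith) (fun θ hθ => by
          rw [min_eq_right hw1, max_eq_left hw1] at hθ
          exact hfC θ ⟨hθ.1, hθ.2.trans_le hw2⟩) (by rw [hw3]; linarith)))
      have r2 := Reach.single (f := fun _ x => f x) (p := (s - (L - (t - s)) / 2, ℓ w)) (q := (t, ℓ m))
        hu ⟨ht0, ht1⟩ (Or.inl (future_line hf hf1 hD hl hC (by linarith) (fun θ hθ => by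
          rw [min_eq_left hw2, max_eq_right hw2] at hθ
          exact hfC θ ⟨hw1.trans_lt hθ.1, hθ.2⟩) (by rw [hw4]; linarith)))
      refine (r1.trans r2).mono ?_
      dsimp only
      rw [abs_of_nonpos (by linarith), abs_of_nonneg (by linarith)]
      linarith

theorem reach_pow {f : X → ℝ} (hf : Continuous f) (hf1 : ∀ x, 1 ≤ f x) {ℓ : ℝ → X} {D : ℝ}
    (hD : 0 ≤ D) (hl : ∀ u v, dist (ℓ u) (ℓ v) ≤ D * |u - v|) {C : ℝ} (hC : 1 ≤ C) (N : ℕ) :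
    ∀ {s t l m : ℝ}, s ∈ Icc (0:ℝ) 1 → t ∈ Icc (0:ℝ) 1 → l ≤ m →
    (∀ θ ∈ Ioo l m, f (ℓ θ) ≤ C) →
    C * (D * (m - l)) ≤ 2 ^ N * (1 / 2) →
    Reach (fun _ x => f x) (s, ℓ l) (t, ℓ m) (max |t - s| (C * (D * (m - l)))) := by
  induction N with
  | zero =>
    intro s t l m hs ht hlm hfC hL
    exact reach_base hf hf1 hD hl hC hs ht hlm hfC (by simpa using hL)
  | succ N ih =>
    intro s t l m hs ht hlm hfC hL
    rw [pow_succ] at hL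
    have hu : (s + t) / 2 ∈ Icc (0:ℝ) 1 := by
      constructor <;> linarith [hs.1, hs.2, ht.1, ht.2]
    have r1 := ih (s := s) (t := (s + t) / 2) (l := l) (m := (l + m) / 2) hs hu (by linarith)
      (fun θ hθ => hfC θ ⟨hθ.1, by linarith [hθ.2]⟩)
      (by rw [show (l + m) / 2 - l = (m - l) / 2 by ring]; linarith)
    have r2 := ih (s := (s + t) / 2) (t := t) (l := (l + m) / 2) (m := m) hu ht (by linarith)
      (fun θ hθ => hfC θ ⟨by linarith [hθ.1], hθ.2⟩)
      (by rw [show m - (l + m) / 2 = (m - l) / 2 by ring]; linarith)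
    refine (r1.trans r2).mono ?_
    rw [show (l + m) / 2 - l = (m - l) / 2 by ring, show m - (l + m) / 2 = (m - l) / 2 by ring,
      show (s + t) / 2 - s = (t - s) / 2 by ring, show t - (s + t) / 2 = (t - s) / 2 by ring,
      abs_div, abs_two]
    have h1 := le_max_left |t - s| (C * (D * (m - l)))
    have h2 := le_max_right |t - s| (C * (D * (m - l)))
    have : max (|t - s| / 2) (C * (D * ((m - l) / 2))) ≤ max |t - s| (C * (D * (m - l))) / 2 :=
      max_le (by linarith) (by linarith)
    linarith

theorem reach_line {f : X → ℝ} (hf : Continuous f) (hf1 : ∀ x, 1 ≤ f x) {ℓ : ℝ → X} {D : ℝ}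
    (hD : 0 ≤ D) (hl : ∀ u v, dist (ℓ u) (ℓ v) ≤ D * |u - v|) {C : ℝ} (hC : 1 ≤ C)
    {s t l m : ℝ} (hs : s ∈ Icc (0:ℝ) 1) (ht : t ∈ Icc (0:ℝ) 1) (hlm : l ≤ m)
    (hfC : ∀ θ ∈ Ioo l m, f (ℓ θ) ≤ C) :
    Reach (fun _ x => f x) (s, ℓ l) (t, ℓ m) (max |t - s| (C * (D * (m - l)))) := by
  obtain ⟨N, hN⟩ := pow_unbounded_of_one_lt (C * (D * (m - l)) * 2) (one_lt_two : (1:ℝ) < 2)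
  exact reach_pow hf hf1 hD hl hC N hs ht hlm hfC (by linarith)

theorem future_weaken {f : X → ℝ} (hf1 : ∀ x, 1 ≤ f x) {p q : ℝ × X}
    (h : FutureRelated (fun _ x => f x) p q) : FutureRelated (tWarp fun _ => (1:ℝ)) p q := by
  obtain ⟨h1, x, hxp, hxq, h2, hc, h3⟩ := h
  refine ⟨h1, x, hxp, hxq, h2, hc, fun c hc d hd hcd => (h3 c hc d hd hcd).trans ?_⟩
  apply ENNReal.ofReal_le_ofReal
  simp only [tWarp]
  by_cases hi : IntervalIntegrable (fun t => 1 / f (x t)) volume c d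
  · apply intervalIntegral.integral_mono_on hcd hi intervalIntegrable_const
    intro t _
    exact one_div_le_one_div_of_le one_pos (hf1 _)
  · rw [intervalIntegral.integral_undef hi]
    simpa using hcd

theorem dist_le_of_future {p q : ℝ × X} (h : FutureRelated (tWarp fun _ => (1:ℝ)) p q) :
    dist p.2 q.2 ≤ q.1 - p.1 := by
  obtain ⟨h1, x, hxp, hxq, h2, hc, h3⟩ := h
  have h4 := h3 p.1 (left_mem_Icc.2 h1) q.1 (right_mem_Icc.2 h1) h1
  have h5 := (eVariationOn.edist_le x (left_mem_Icc.2 h1) (right_mem_Icc.2 h1)).trans h4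
  rw [hxp, hxq, edist_dist] at h5
  simp only [tWarp] at h5
  rw [ENNReal.ofReal_le_ofReal_iff (by simpa using h1)] at h5
  simpa using h5

theorem max_le_nullLength {p q : ℝ × X} (γ : PiecewiseCausal (tWarp fun _ => (1:ℝ)) 0 1 p q) :
    max |q.1 - p.1| (dist p.2 q.2) ≤ nullLength (fun p => p.1) γ := by
  apply max_le
  · have := dist_le_range_sum_dist (fun i => (γ.pt i).1) γ.k
    simp only [γ.h0, γ.hlast, Real.dist_eq] at this
    rw [abs_sub_comm]
    refine this.trans (le_of_eq (Finset.sum_congr rfl fun i _ => abs_sub_comm _ _))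
  · have := dist_le_range_sum_dist (fun i => (γ.pt i).2) γ.k
    simp only [γ.h0, γ.hlast] at this
    refine this.trans (Finset.sum_le_sum fun i hi => ?_)
    rcases γ.piece i (Finset.mem_range.1 hi) with h | h
    · exact (dist_le_of_future h).trans (le_abs_self _)
    · rw [dist_comm, abs_sub_comm]
      exact (dist_le_of_future h).trans (le_abs_self _)

theorem nullDist_lower {f : X → ℝ} (hf1 : ∀ x, 1 ≤ f x) {p q : ℝ × X} {L : ℝ}
    (hR : Reach (fun _ x => f x) p q L) :
    nullDist (tWarp fun _ => (1:ℝ)) (fun p => p.1) 0 1 p q ≤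
      nullDist (fun _ x => f x) (fun p => p.1) 0 1 p q ∧
    max |q.1 - p.1| (dist p.2 q.2) ≤
      nullDist (tWarp fun _ => (1:ℝ)) (fun p => p.1) 0 1 p q := by
  have sub : ∀ γ : PiecewiseCausal (fun _ x => f x) 0 1 p q,
      ∃ δ : PiecewiseCausal (tWarp fun _ => (1:ℝ)) 0 1 p q,
        nullLength (fun p => p.1) γ = nullLength (fun p => p.1) δ := fun γ =>
    ⟨⟨γ.k, γ.hk, γ.pt, γ.h0, γ.hlast, γ.hstrip, fun i hi =>
      (γ.piece i hi).imp (future_weaken hf1) (future_weaken hf1)⟩, rfl⟩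
  obtain ⟨γ, -⟩ := hR
  constructor
  · refine le_csInf ⟨_, γ, rfl⟩ ?_
    rintro _ ⟨δ, rfl⟩
    obtain ⟨ε, hε⟩ := sub δ
    exact csInf_le (bddBelow_null _ p q) ⟨ε, hε⟩
  · obtain ⟨ε, hε⟩ := sub γ
    refine le_csInf ⟨_, ε, rfl⟩ ?_
    rintro _ ⟨δ, rfl⟩
    exact max_le_nullLength δ

end Helpers

theorem exists_line {n : ℕ} (x y : Disk n) : ∃ ℓ : ℝ → Disk n, ℓ 0 = x ∧ ℓ 1 = y ∧
    (∀ u v, dist (ℓ u) (ℓ v) ≤ dist x y * |u - v|) ∧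
    (∀ u ∈ Icc (0:ℝ) 1, ∀ v ∈ Icc (0:ℝ) 1, dist (ℓ u) (ℓ v) = dist x y * |u - v|) := by
  let ℓ : ℝ → Disk n := fun u =>
    ⟨AffineMap.lineMap (x : EuclideanSpace ℝ (Fin n)) (y : EuclideanSpace ℝ (Fin n))
      (projIcc (0:ℝ) 1 zero_le_one u : ℝ),
      (convex_closedBall _ _).lineMap_mem x.2 y.2 (projIcc (0:ℝ) 1 zero_le_one u).2⟩
  have hd : ∀ u v, dist (ℓ u) (ℓ v) = dist x y *
      |(projIcc (0:ℝ) 1 zero_le_one u : ℝ) - projIcc (0:ℝ) 1 zero_le_one v| := by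
    intro u v
    simp only [ℓ, Subtype.dist_eq]
    rw [dist_lineMap_lineMap, Real.dist_eq, mul_comm]
  refine ⟨ℓ, ?_, ?_, ?_, ?_⟩
  · apply Subtype.ext
    simp [ℓ]
  · apply Subtype.ext
    simp [ℓ]
  · intro u v
    rw [hd]
    exact mul_le_mul_of_nonneg_left (abs_projIcc_sub_projIcc zero_le_one) dist_nonneg
  · intro u hu v hv
    rw [hd, projIcc_of_mem _ hu, projIcc_of_mem _ hv]

theorem reach_disk {n : ℕ} {f : Disk n → ℝ} (hf : Continuous f) (hf1 : ∀ x, 1 ≤ f x)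
    {C ρ : ℝ} (hC : ∀ x, f x ≤ C) (hC1 : 1 ≤ C)
    (hout : ∀ x : Disk n, ρ < ‖(x : EuclideanSpace ℝ (Fin n))‖ → f x ≤ 1) (hρ : 0 ≤ ρ)
    {p q : ℝ × Disk n} (hp : p.1 ∈ Icc (0:ℝ) 1) (hq : q.1 ∈ Icc (0:ℝ) 1) :
    Reach (fun _ x => f x) p q (max |q.1 - p.1| (dist p.2 q.2) + C * (2 * ρ)) := by
  obtain ⟨s, x⟩ := p
  obtain ⟨t, y⟩ := q
  dsimp only at hp hq ⊢
  obtain ⟨ℓ, h0, h1, hl, hle⟩ := exists_line x y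
  set D := dist x y with hDd
  have hD : 0 ≤ D := dist_nonneg
  set M := max |t - s| D with hM
  have hM1 : |t - s| ≤ M := le_max_left _ _
  have hM2 : D ≤ M := le_max_right _ _
  have hlc : Continuous ℓ := (LipschitzWith.of_dist_le_mul (K := D.toNNReal) fun u v => by
    rw [Real.coe_toNNReal D hD, Real.dist_eq]; exact hl u v).continuous
  rw [← h0, ← h1]
  let A : Set ℝ := Icc 0 1 ∩ {u | ‖(ℓ u : EuclideanSpace ℝ (Fin n))‖ ≤ ρ}
  have hA : IsCompact A := isCompact_Icc.inter_right
    (isClosed_le (continuous_norm.comp (continuous_subtype_val.comp hlc)) continuous_const)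
  have hnA : ∀ u ∈ Icc (0:ℝ) 1, u ∉ A → f (ℓ u) ≤ 1 := fun u hu hn =>
    hout _ (by by_contra h; exact hn ⟨hu, not_lt.1 h⟩)
  rcases A.eq_empty_or_nonempty with he | hne
  · have r := reach_line hf hf1 hD hl le_rfl hp hq zero_le_one (fun θ hθ =>
      hnA θ ⟨hθ.1.le, hθ.2.le⟩ (by simp [he]))
    refine r.mono ?_
    have : 0 ≤ C * (2 * ρ) := by positivity
    rw [one_mul, sub_zero, mul_one]
    linarith
  · obtain ⟨a, haA, ha⟩ := hA.exists_isLeast hne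
    obtain ⟨b, hbA, hb⟩ := hA.exists_isGreatest hne
    have hab : a ≤ b := ha hbA
    obtain ⟨⟨ha0, ha1⟩, haρ⟩ := haA
    obtain ⟨⟨hb0, hb1⟩, hbρ⟩ := hbA
    have hDab : D * (b - a) ≤ 2 * ρ := by
      have := hle b ⟨hb0, hb1⟩ a ⟨ha0, ha1⟩
      rw [abs_of_nonneg (sub_nonneg.2 hab)] at this
      rw [← this, Subtype.dist_eq, dist_eq_norm]
      refine (norm_sub_le _ _).trans ?_
      change _ ≤ ρ at haρ hbρ
      linarith
    have hu : ∀ c ∈ Icc (0:ℝ) 1, s + c * (t - s) ∈ Icc (0:ℝ) 1 := by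
      rintro c ⟨hc0, hc1⟩
      obtain ⟨hs0, hs1⟩ := hp
      obtain ⟨ht0, ht1⟩ := hq
      constructor <;> nlinarith
    have r1 := reach_line hf hf1 hD hl le_rfl hp (hu a ⟨ha0, ha1⟩) ha0 (fun θ hθ =>
      hnA θ ⟨hθ.1.le, hθ.2.le.trans ha1⟩ (fun h => absurd (ha h) (not_le.2 hθ.2)))
    have r2 := reach_line hf hf1 hD hl hC1 (hu a ⟨ha0, ha1⟩) (hu b ⟨hb0, hb1⟩) hab
      (fun θ _ => hC _)
    have r3 := reach_line hf hf1 hD hl le_rfl (hu b ⟨hb0, hb1⟩) hq hb1 (fun θ hθ =>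
      hnA θ ⟨hb0.trans hθ.1.le, hθ.2.le⟩ (fun h => absurd (hb h) (not_le.2 hθ.1)))
    refine ((r1.trans r2).trans r3).mono ?_
    have e1 : max |s + a * (t - s) - s| (1 * (D * (a - 0))) ≤ M * a := by
      rw [add_sub_cancel_left, abs_mul, abs_of_nonneg ha0]
      apply max_le <;> nlinarith
    have e3 : max |t - (s + b * (t - s))| (1 * (D * (1 - b))) ≤ M * (1 - b) := by
      rw [show t - (s + b * (t - s)) = (1 - b) * (t - s) by ring, abs_mul,
        abs_of_nonneg (sub_nonneg.2 hb1)]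
      apply max_le <;> nlinarith
    have hM0 : 0 ≤ M := hD.trans hM2
    have e2 : max |s + b * (t - s) - (s + a * (t - s))| (C * (D * (b - a))) ≤
        M * (b - a) + C * (2 * ρ) := by
      rw [show s + b * (t - s) - (s + a * (t - s)) = (b - a) * (t - s) by ring, abs_mul,
        abs_of_nonneg (sub_nonneg.2 hab)]
      have k1 : 0 ≤ C * (2 * ρ) := by positivity
      have k2 : C * (D * (b - a)) ≤ C * (2 * ρ) := mul_le_mul_of_nonneg_left hDab (by linarith)
      have k3 : 0 ≤ M * (b - a) := mul_nonneg hM0 (sub_nonneg.2 hab)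
      have k4 : (b - a) * |t - s| ≤ M * (b - a) := by
        rw [mul_comm]; exact mul_le_mul_of_nonneg_right hM1 (sub_nonneg.2 hab)
      apply max_le <;> linarith
    linarith

end NullDistPaper

/-- **Example 3.7 (`Ex-BlowupRate`): blow up rate can matter.**
Let `(𝔻ⁿ,σ)` be the flat disk and `α ∈ (0,1)`.  Define `fⱼ` radially by
`fⱼ(r) = jᵅ` on `[0, 1/(2j)]`, decreasing on `[1/(2j), 1/j]`, and `fⱼ(r) = 1`
otherwise; `gⱼ = -dt² + fⱼ²σ`, `g₀ = -dt² + σ` on `M = [0,1] × 𝔻ⁿ`.  Then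
`d̂_{t,g₀}(p,q) ≤ d̂_{t,gⱼ}(p,q) ≤ d̂_{t,g₀}(p,q) + 2/j + 2j^{α-1}` for all
`p, q ∈ M`; in particular `d̂_{t,gⱼ} → d̂_{t,g₀}` uniformly. -/
theorem nullDist_subcritical_blowup_rate
    (n : ℕ) (α : ℝ) (hα : 0 < α ∧ α < 1)
    (F : ℕ → ℝ → ℝ)
    (hFc : ∀ j : ℕ, 1 ≤ j → ContinuousOn (F j) (Set.Icc 0 1))
    (hFa : ∀ j : ℕ, 1 ≤ j → ∀ r ∈ Set.Icc (0:ℝ) (1 / (2 * (j:ℝ))), F j r = (j : ℝ) ^ α)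
    (hFm : ∀ j : ℕ, 1 ≤ j → AntitoneOn (F j) (Set.Icc (1 / (2 * (j:ℝ))) (1 / (j:ℝ))))
    (hFb : ∀ j : ℕ, 1 ≤ j → ∀ r ∈ Set.Icc (1 / (j:ℝ)) 1, F j r = 1)
    (hFone : ∀ j : ℕ, 1 ≤ j → ∀ r ∈ Set.Icc (0:ℝ) 1, 1 ≤ F j r) :
    (∀ j : ℕ, 1 ≤ j → ∀ p q : ℝ × Disk n,
      p.1 ∈ Set.Icc (0:ℝ) 1 → q.1 ∈ Set.Icc (0:ℝ) 1 →
      nullDist (tWarp fun _ => (1:ℝ)) (fun p => p.1) 0 1 p q ≤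
        nullDist (fun _ (x : Disk n) => F j ‖(x : EuclideanSpace ℝ (Fin n))‖)
          (fun p => p.1) 0 1 p q ∧
      nullDist (fun _ (x : Disk n) => F j ‖(x : EuclideanSpace ℝ (Fin n))‖)
          (fun p => p.1) 0 1 p q ≤
        nullDist (tWarp fun _ => (1:ℝ)) (fun p => p.1) 0 1 p q
          + 2 / (j:ℝ) + 2 * (j:ℝ) ^ (α - 1)) ∧
    -- in particular, uniform convergence `d̂_{t,gⱼ} → d̂_{t,g₀}`:
    (∀ ε > 0, ∃ N : ℕ, ∀ j ≥ N, ∀ p q : ℝ × Disk n,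
      p.1 ∈ Set.Icc (0:ℝ) 1 → q.1 ∈ Set.Icc (0:ℝ) 1 →
      |nullDist (fun _ (x : Disk n) => F j ‖(x : EuclideanSpace ℝ (Fin n))‖)
          (fun p => p.1) 0 1 p q -
        nullDist (tWarp fun _ => (1:ℝ)) (fun p => p.1) 0 1 p q| ≤ ε) := by
  have main : ∀ j : ℕ, 1 ≤ j → ∀ p q : ℝ × Disk n,
      p.1 ∈ Set.Icc (0:ℝ) 1 → q.1 ∈ Set.Icc (0:ℝ) 1 →
      nullDist (tWarp fun _ => (1:ℝ)) (fun p => p.1) 0 1 p q ≤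
        nullDist (fun _ (x : Disk n) => F j ‖(x : EuclideanSpace ℝ (Fin n))‖)
          (fun p => p.1) 0 1 p q ∧
      nullDist (fun _ (x : Disk n) => F j ‖(x : EuclideanSpace ℝ (Fin n))‖)
          (fun p => p.1) 0 1 p q ≤
        nullDist (tWarp fun _ => (1:ℝ)) (fun p => p.1) 0 1 p q
          + 2 / (j:ℝ) + 2 * (j:ℝ) ^ (α - 1) := by
    intro j hj p q hp hq
    have hj1 : (1:ℝ) ≤ j := by exact_mod_cast hj
    have hj0 : (0:ℝ) < j := by linarith
    have hC1 : 1 ≤ (j:ℝ) ^ α := Real.one_le_rpow hj1 hα.1.le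
    have hmem : ∀ x : Disk n, ‖(x : EuclideanSpace ℝ (Fin n))‖ ∈ Icc (0:ℝ) 1 := fun x =>
      ⟨norm_nonneg _, mem_closedBall_zero_iff.1 x.2⟩
    have hhalf : 1 / (2 * (j:ℝ)) ≤ 1 / (j:ℝ) :=
      one_div_le_one_div_of_le hj0 (by linarith)
    have hcont : Continuous fun x : Disk n => F j ‖(x : EuclideanSpace ℝ (Fin n))‖ :=
      (hFc j hj).comp_continuous (continuous_norm.comp continuous_subtype_val) hmem
    have hone : ∀ x : Disk n, 1 ≤ F j ‖(x : EuclideanSpace ℝ (Fin n))‖ := fun x =>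
      hFone j hj _ (hmem x)
    have hle : ∀ x : Disk n, F j ‖(x : EuclideanSpace ℝ (Fin n))‖ ≤ (j:ℝ) ^ α := by
      intro x
      obtain ⟨h0, h1⟩ := hmem x
      rcases le_total ‖(x : EuclideanSpace ℝ (Fin n))‖ (1 / (2 * (j:ℝ))) with h | h
      · exact (hFa j hj _ ⟨h0, h⟩).le
      · rcases le_total ‖(x : EuclideanSpace ℝ (Fin n))‖ (1 / (j:ℝ)) with h' | h'
        · rw [← hFa j hj (1 / (2 * (j:ℝ))) ⟨by positivity, le_rfl⟩]
          exact hFm j hj ⟨le_rfl, hhalf⟩ ⟨h, h'⟩ h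
        · rw [hFb j hj _ ⟨h', h1⟩]
          exact hC1
    have R := reach_disk (ρ := 1 / (j:ℝ)) hcont hone hle hC1
      (fun x hx => (hFb j hj _ ⟨hx.le, (hmem x).2⟩).le) (by positivity) hp hq
    obtain ⟨l1, l2⟩ := nullDist_lower hone R
    refine ⟨l1, R.nullDist_le.trans ?_⟩
    have e : (j:ℝ) ^ α * (2 * (1 / (j:ℝ))) = 2 * (j:ℝ) ^ (α - 1) := by
      rw [Real.rpow_sub_one hj0.ne']; ring
    rw [e]
    have : 0 ≤ 2 / (j:ℝ) := by positivity
    linarith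
  refine ⟨main, ?_⟩
  intro ε hε
  have ht : Tendsto (fun j : ℕ => 2 / (j:ℝ) + 2 * (j:ℝ) ^ (α - 1)) atTop (𝓝 0) := by
    have t1 : Tendsto (fun j : ℕ => 2 / (j:ℝ)) atTop (𝓝 0) :=
      tendsto_const_div_atTop_nhds_zero_nat 2
    have t2 : Tendsto (fun j : ℕ => (j:ℝ) ^ (-(1 - α))) atTop (𝓝 0) :=
      (tendsto_rpow_neg_atTop (by linarith [hα.2])).comp tendsto_natCast_atTop_atTop
    simpa using t1.add (t2.const_mul 2)
  obtain ⟨N, hN⟩ := eventually_atTop.1 ((ht.eventually (gt_mem_nhds hε)).and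
    (eventually_ge_atTop 1))
  refine ⟨N, fun j hj p q hp hq => ?_⟩
  obtain ⟨k1, k2⟩ := hN j hj
  obtain ⟨m1, m2⟩ := main j k2 p q hp hq
  rw [abs_of_nonneg (by linarith)]
  linarith
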